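/- Let A be an integral domain, integrally closed in its field of fractions K, H a Z-graded associative A-algebra, finitely generated and free over A, θ : A → L a ring homomorphism into a field L with L the field of fractions of θ(A); assume LH is split or L is perfect, so that p_L is injective. Then the graded decomposition map d^gr_θ : R_0^+(KH) → R_0^+(LH) is the unique map satisfying p_L ∘ d^gr_θ = t_θ ∘ p_K: if d, d' : R_0^+(KH) → R_0^+(LH) both satisfy this commutation, then d = d'. In particular, d^gr_θ does not depend on the choice of valuation ring O ⊆ K with A ⊆ O and J(O) ∩ A = Ker(θ) used to define it. -/

import Mathlib

universe u

open DirectSum Function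

/-! ## Modules over `S ⊗_A H`

For an `A`-algebra `H` and a commutative `A`-algebra `S`, a (finitely generated) module over
the `S`-algebra `S ⊗_A H` is the same thing as an `S`-module together with a commuting
`H`-action such that the two induced `A`-actions agree.  We package this data in a structure. -/

structure ModPkg (A : Type u) [CommRing A] (H : Type u) [Ring H] [Algebra A H]
    (S : Type u) [CommRing S] [Algebra A S] : Type (u + 1) where
  carrier : Type u
  [acg : AddCommGroup carrier]
  [modS : Module S carrier]
  [modH : Module H carrier]
  smul_comm' : ∀ (h : H) (s : S) (x : carrier), h • s • x = s • h • x
  compat : ∀ (a : A) (x : carrier), (algebraMap A H a) • x = (algebraMap A S a) • x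
  [fin : Module.Finite S carrier]

attribute [instance] ModPkg.acg ModPkg.modS ModPkg.modH ModPkg.fin

section Ungraded

variable {A : Type u} [CommRing A] {H : Type u} [Ring H] [Algebra A H]
  {S : Type u} [CommRing S] [Algebra A S]

namespace ModPkg

/-- A subgroup stable under both scalar actions, i.e. an `S ⊗_A H`-submodule. -/
def IsStable (M : ModPkg A H S) (p : AddSubgroup M.carrier) : Prop :=
  (∀ (s : S), ∀ x ∈ p, s • x ∈ p) ∧ (∀ (h : H), ∀ x ∈ p, h • x ∈ p)

/-- Simplicity of an `S ⊗_A H`-module. -/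
def Simple (M : ModPkg A H S) : Prop :=
  Nontrivial M.carrier ∧ ∀ p : AddSubgroup M.carrier, M.IsStable p → p = ⊥ ∨ p = ⊤

/-- Isomorphism of `S ⊗_A H`-modules. -/
def Iso (M N : ModPkg A H S) : Prop :=
  ∃ e : M.carrier ≃+ N.carrier,
    (∀ (s : S) (x : M.carrier), e (s • x) = s • e x) ∧
    (∀ (h : H) (x : M.carrier), e (h • x) = h • e x)

/-- The action of an element of `H` as an `S`-linear endomorphism. -/
noncomputable def act (M : ModPkg A H S) (h : H) : M.carrier →ₗ[S] M.carrier where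
  toFun x := h • x
  map_add' x y := smul_add h x y
  map_smul' s x := by simpa using M.smul_comm' h s x

/-- The character of an `S ⊗_A H`-module, as a function on `H`. -/
noncomputable def char (M : ModPkg A H S) : H → S :=
  fun h => LinearMap.trace S M.carrier (M.act h)

/-- The factor `q/p` is isomorphic to `M` (as `S ⊗_A H`-modules), witnessed by a surjection
`q → M` with kernel `p`. -/
def IsFactor (V : ModPkg A H S) (p q : AddSubgroup V.carrier) (M : ModPkg A H S) : Prop :=
  ∃ φ : q →+ M.carrier,
    Surjective φ ∧
    (∀ x : q, φ x = 0 ↔ (x : V.carrier) ∈ p) ∧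
    (∀ (s : S) (x y : q), (y : V.carrier) = s • (x : V.carrier) → φ y = s • φ x) ∧
    (∀ (h : H) (x y : q), (y : V.carrier) = h • (x : V.carrier) → φ y = h • φ x)

end ModPkg

/-- An (ungraded) composition series of an `S ⊗_A H`-module. -/
structure CompSeries (V : ModPkg A H S) : Type u where
  len : ℕ
  c : Fin (len + 1) → AddSubgroup V.carrier
  mono : ∀ t : Fin len, c t.castSucc ≤ c t.succ
  bot : c 0 = ⊥
  top : c (Fin.last len) = ⊤
  stable : ∀ t, V.IsStable (c t)
  steps : ∀ t : Fin len, c t.castSucc ≠ c t.succ ∧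
    ∀ p : AddSubgroup V.carrier, V.IsStable p → c t.castSucc ≤ p → p ≤ c t.succ →
      p = c t.castSucc ∨ p = c t.succ

/-- The multiplicity of the simple module `M` in a composition series. -/
noncomputable def ModPkg.mult (V : ModPkg A H S) (cs : CompSeries V) (M : ModPkg A H S) : ℕ :=
  Nat.card { t : Fin cs.len // V.IsFactor (cs.c t.castSucc) (cs.c t.succ) M }

end Ungraded

/-- The algebra `S ⊗_A H` is split: the endomorphism algebra of every simple module is `S`. -/
def SplitAlg (A : Type u) [CommRing A] (H : Type u) [Ring H] [Algebra A H]
    (S : Type u) [CommRing S] [Algebra A S] : Prop :=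
  ∀ M : ModPkg A H S, M.Simple →
    ∀ f : M.carrier →+ M.carrier,
      (∀ (s : S) (x : M.carrier), f (s • x) = s • f x) →
      (∀ (h : H) (x : M.carrier), f (h • x) = h • f x) →
      ∃ s : S, ∀ x, f x = s • x

/-- The set of irreducible characters of `S ⊗_A H`. -/
def IrrChars (A : Type u) [CommRing A] (H : Type u) [Ring H] [Algebra A H]
    (S : Type u) [CommRing S] [Algebra A S] : Set (H → S) :=
  { χ | ∃ M : ModPkg A H S, M.Simple ∧ χ = M.char }

/-! ## Graded modules over `S ⊗_A H` for a `ℤ`-graded algebra `H = ⊕ 𝒜 i` -/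

structure GrMod (A : Type u) [CommRing A] (H : Type u) [Ring H] [Algebra A H]
    (𝒜 : ℤ → Submodule A H) (S : Type u) [CommRing S] [Algebra A S] : Type (u + 1) where
  carrier : Type u
  [acg : AddCommGroup carrier]
  [modS : Module S carrier]
  [modH : Module H carrier]
  smul_comm' : ∀ (h : H) (s : S) (x : carrier), h • s • x = s • h • x
  compat : ∀ (a : A) (x : carrier), (algebraMap A H a) • x = (algebraMap A S a) • x
  [fin : Module.Finite S carrier]
  grading : ℤ → Submodule S carrier
  [decomp : DirectSum.Decomposition grading]
  grading_smul : ∀ (i j : ℤ) (h : H), h ∈ 𝒜 i → ∀ x ∈ grading j, h • x ∈ grading (i + j)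

attribute [instance] GrMod.acg GrMod.modS GrMod.modH GrMod.fin GrMod.decomp

section Graded

variable {A : Type u} [CommRing A] {H : Type u} [Ring H] [Algebra A H]
  {𝒜 : ℤ → Submodule A H} {S : Type u} [CommRing S] [Algebra A S]

namespace GrMod

/-- The underlying ungraded module of a graded module. -/
def forget (V : GrMod A H 𝒜 S) : ModPkg A H S where
  carrier := V.carrier
  acg := V.acg
  modS := V.modS
  modH := V.modH
  smul_comm' := V.smul_comm'
  compat := V.compat
  fin := V.fin

/-- The action of a degree-`0` element of `H` on the degree-`i` piece of a graded module,
as an `S`-linear endomorphism; this is the representation `ρ_{V_i}` restricted to `H_0`. -/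
noncomputable def degAct (V : GrMod A H 𝒜 S) (h : 𝒜 0) (i : ℤ) :
    V.grading i →ₗ[S] V.grading i where
  toFun x := ⟨(h : H) • (x : V.carrier), by
    simpa using V.grading_smul 0 i (h : H) h.2 (x : V.carrier) x.2⟩
  map_add' x y := by
    apply Subtype.ext
    simp [smul_add]
  map_smul' s x := by
    apply Subtype.ext
    simpa using V.smul_comm' (h : H) s (x : V.carrier)

/-- A subgroup which is an `S ⊗_A H`-submodule and is graded. -/
def IsGrSub (V : GrMod A H 𝒜 S) (p : AddSubgroup V.carrier) : Prop :=
  V.forget.IsStable p ∧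
    ∀ x ∈ p, ∀ i : ℤ, ((DirectSum.decompose V.grading x i : V.grading i) : V.carrier) ∈ p

/-- A graded module is graded-simple if it is nonzero and has no nontrivial graded submodule. -/
def GrSimple (V : GrMod A H 𝒜 S) : Prop :=
  Nontrivial V.carrier ∧ ∀ p : AddSubgroup V.carrier, V.IsGrSub p → p = ⊥ ∨ p = ⊤

/-- Isomorphism of graded modules. -/
def GrIso (V W : GrMod A H 𝒜 S) : Prop :=
  ∃ e : V.carrier ≃+ W.carrier,
    (∀ (s : S) (x : V.carrier), e (s • x) = s • e x) ∧
    (∀ (h : H) (x : V.carrier), e (h • x) = h • e x) ∧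
    (∀ (i : ℤ), ∀ x ∈ V.grading i, e x ∈ W.grading i)

/-- `W` is the shift `V⟨j⟩` of `V`, i.e. `W_i = V_{i-j}`. -/
def IsShiftOf (W V : GrMod A H 𝒜 S) (j : ℤ) : Prop :=
  ∃ e : W.carrier ≃+ V.carrier,
    (∀ (s : S) (x : W.carrier), e (s • x) = s • e x) ∧
    (∀ (h : H) (x : W.carrier), e (h • x) = h • e x) ∧
    (∀ (i : ℤ), ∀ x ∈ W.grading i, e x ∈ V.grading (i - j))

/-- The factor `q/p` of a graded module is isomorphic, as a graded module, to the shift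
`M⟨n⟩` of `M`. -/
def IsFactorShift (V : GrMod A H 𝒜 S) (p q : AddSubgroup V.carrier)
    (M : GrMod A H 𝒜 S) (n : ℤ) : Prop :=
  ∃ φ : q →+ M.carrier,
    Surjective φ ∧
    (∀ x : q, φ x = 0 ↔ (x : V.carrier) ∈ p) ∧
    (∀ (s : S) (x y : q), (y : V.carrier) = s • (x : V.carrier) → φ y = s • φ x) ∧
    (∀ (h : H) (x y : q), (y : V.carrier) = h • (x : V.carrier) → φ y = h • φ x) ∧
    (∀ (i : ℤ) (x : q), (x : V.carrier) ∈ V.grading i → φ x ∈ M.grading (i - n)) ∧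
    (∀ (i : ℤ), ∀ m ∈ M.grading (i - n), ∃ x : q, (x : V.carrier) ∈ V.grading i ∧ φ x = m)

end GrMod

/-- A graded composition series of a graded module. -/
structure GrCompSeries (V : GrMod A H 𝒜 S) : Type u where
  len : ℕ
  c : Fin (len + 1) → AddSubgroup V.carrier
  mono : ∀ t : Fin len, c t.castSucc ≤ c t.succ
  bot : c 0 = ⊥
  top : c (Fin.last len) = ⊤
  graded : ∀ t, V.IsGrSub (c t)
  steps : ∀ t : Fin len, c t.castSucc ≠ c t.succ ∧
    ∀ p : AddSubgroup V.carrier, V.IsGrSub p → c t.castSucc ≤ p → p ≤ c t.succ →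
      p = c t.castSucc ∨ p = c t.succ

/-- The multiplicity `[V : M⟨n⟩]^gr` of the shifted graded simple module `M⟨n⟩` in a graded
composition series of `V`. -/
noncomputable def GrMod.multShift (V : GrMod A H 𝒜 S) (cs : GrCompSeries V)
    (M : GrMod A H 𝒜 S) (n : ℤ) : ℕ :=
  Nat.card { t : Fin cs.len // V.IsFactorShift (cs.c t.castSucc) (cs.c t.succ) M n }

/-- The graded decomposition number `∑_n q^n [V : M⟨n⟩]^gr ∈ ℕ[q,q⁻¹]`. -/
noncomputable def GrMod.entryPoly (V : GrMod A H 𝒜 S) (cs : GrCompSeries V)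
    (M : GrMod A H 𝒜 S) : LaurentPolynomial ℕ :=
  ∑ᶠ n : ℤ, (V.multShift cs M n) • LaurentPolynomial.T n

/-- A short exact sequence of graded modules (morphisms are of degree `0`). -/
structure GrSES (X Y Z : GrMod A H 𝒜 S) : Type u where
  f : X.carrier →+ Y.carrier
  g : Y.carrier →+ Z.carrier
  f_smulS : ∀ (s : S) (x : X.carrier), f (s • x) = s • f x
  f_smulH : ∀ (h : H) (x : X.carrier), f (h • x) = h • f x
  g_smulS : ∀ (s : S) (y : Y.carrier), g (s • y) = s • g y
  g_smulH : ∀ (h : H) (y : Y.carrier), g (h • y) = h • g y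
  inj : Injective f
  surj : Surjective g
  exact : ∀ y : Y.carrier, g y = 0 ↔ ∃ x, f x = y
  f_graded : ∀ (i : ℤ), ∀ x ∈ X.grading i, f x ∈ Y.grading i
  g_graded : ∀ (i : ℤ), ∀ y ∈ Y.grading i, g y ∈ Z.grading i

end Graded

/-- The defining relations of the Grothendieck group of finite-dimensional graded modules. -/
def grRelSet (A : Type u) [CommRing A] (H : Type u) [Ring H] [Algebra A H]
    (𝒜 : ℤ → Submodule A H) (S : Type u) [CommRing S] [Algebra A S] :
    Set (FreeAbelianGroup (GrMod A H 𝒜 S)) :=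
  { z | ∃ X Y Z : GrMod A H 𝒜 S, Nonempty (GrSES X Y Z) ∧
      z = FreeAbelianGroup.of Y - FreeAbelianGroup.of X - FreeAbelianGroup.of Z }

/-- The Grothendieck group `R_0(S ⊗_A H)` of finite-dimensional graded modules. -/
def Groth (A : Type u) [CommRing A] (H : Type u) [Ring H] [Algebra A H]
    (𝒜 : ℤ → Submodule A H) (S : Type u) [CommRing S] [Algebra A S] : Type (u + 1) :=
  FreeAbelianGroup (GrMod A H 𝒜 S) ⧸ AddSubgroup.closure (grRelSet A H 𝒜 S)

noncomputable instance (A : Type u) [CommRing A] (H : Type u) [Ring H] [Algebra A H]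
    (𝒜 : ℤ → Submodule A H) (S : Type u) [CommRing S] [Algebra A S] :
    AddCommGroup (Groth A H 𝒜 S) :=
  inferInstanceAs
    (AddCommGroup (FreeAbelianGroup (GrMod A H 𝒜 S) ⧸ AddSubgroup.closure (grRelSet A H 𝒜 S)))

/-- The class `[V]` of a graded module in the Grothendieck group; `R_0^+` is the set of
all such classes. -/
def GrMod.cls {A : Type u} [CommRing A] {H : Type u} [Ring H] [Algebra A H]
    {𝒜 : ℤ → Submodule A H} {S : Type u} [CommRing S] [Algebra A S]
    (V : GrMod A H 𝒜 S) : Groth A H 𝒜 S :=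
  QuotientAddGroup.mk (FreeAbelianGroup.of V)

section Char

variable {A : Type u} [CommRing A] {H : Type u} [Ring H] [Algebra A H]
  {𝒜 : ℤ → Submodule A H} {S : Type u} [CommRing S] [Algebra A S]

/-- The graded character of a graded module, as a function `H → S[t,t⁻¹]`:
it vanishes on the components of degree `≠ 0` and sends `h₀ ∈ H_0` to
`∑_i t^i χ_{V_i}(h₀)`. -/
noncomputable def GrMod.grChar [DirectSum.Decomposition 𝒜] (V : GrMod A H 𝒜 S) :
    H → LaurentPolynomial S :=
  fun h => ∑ᶠ i : ℤ, LaurentPolynomial.T i *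
    LaurentPolynomial.C
      (LinearMap.trace S (V.grading i) (V.degAct (DirectSum.decompose 𝒜 h 0) i))

/-- The set of irreducible graded characters `{χ^gr_{M⟨j⟩}}`: graded characters of graded
modules whose underlying ungraded module is simple (the grading of a simple module being
unique up to shift). -/
def IrrGrChars (A : Type u) [CommRing A] (H : Type u) [Ring H] [Algebra A H]
    (𝒜 : ℤ → Submodule A H) [DirectSum.Decomposition 𝒜]
    (S : Type u) [CommRing S] [Algebra A S] : Set (H → LaurentPolynomial S) :=
  { χ | ∃ V : GrMod A H 𝒜 S, V.forget.Simple ∧ χ = V.grChar }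

end Char

section FieldCoeffs

variable {A : Type u} [CommRing A] {H : Type u} [Ring H] [Algebra A H]
  {𝒜 : ℤ → Submodule A H} {F : Type u} [Field F] [Algebra A F]

/-- The characteristic polynomial of the action of a degree-`0` element of `H` on the
degree-`i` piece of a graded module. -/
noncomputable def GrMod.cpoly (V : GrMod A H 𝒜 F) (h : 𝒜 0) (i : ℤ) : Polynomial F :=
  LinearMap.charpoly (V.degAct h i)

/-- `L` is a graded `O ⊗_A H`-lattice in the graded `F ⊗_A H`-module `V`: an `O`-submodule,
stable under `H`, graded, finitely generated and free over `O`, any `O`-basis of which is an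
`F`-basis of `V`. -/
def GrMod.IsLattice (O : ValuationSubring F) (V : GrMod A H 𝒜 F)
    (L : AddSubgroup V.carrier) : Prop :=
  (∀ c : F, c ∈ O → ∀ x ∈ L, c • x ∈ L) ∧
  (∀ h : H, ∀ x ∈ L, h • x ∈ L) ∧
  (∀ x ∈ L, ∀ i : ℤ, ((DirectSum.decompose V.grading x i : V.grading i) : V.carrier) ∈ L) ∧
  ∃ (n : ℕ) (b : Fin n → V.carrier),
    LinearIndependent F b ∧ Submodule.span F (Set.range b) = ⊤ ∧ (∀ m, b m ∈ L) ∧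
    (∀ x ∈ L, ∃ c : Fin n → F, (∀ m, c m ∈ O) ∧ x = ∑ m, c m • b m)

/-- The subgroup `J(O)·L` of a lattice `L`, where `J(O)` is the maximal ideal
(= nonunits) of the valuation ring `O`. -/
def GrMod.mSub (O : ValuationSubring F) (V : GrMod A H 𝒜 F)
    (L : AddSubgroup V.carrier) : AddSubgroup V.carrier :=
  AddSubgroup.closure { z | ∃ c : O, ¬ IsUnit c ∧ ∃ y ∈ L, z = (c : F) • y }

/-- `φ` exhibits the graded `k ⊗_A H`-module `Y` as the modular reduction `k ⊗_O L` of the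
graded `O ⊗_A H`-lattice `L`, along the surjection `π : O → k` onto the residue field. -/
def GrMod.Reduces {k : Type u} [Field k] [Algebra A k]
    (O : ValuationSubring F) (π : O →+* k)
    (V : GrMod A H 𝒜 F) (L : AddSubgroup V.carrier)
    (Y : GrMod A H 𝒜 k) (φ : L →+ Y.carrier) : Prop :=
  Surjective φ ∧
  (∀ x : L, φ x = 0 ↔ (x : V.carrier) ∈ GrMod.mSub O V L) ∧
  (∀ (c : O) (x y : L), (y : V.carrier) = (c : F) • (x : V.carrier) → φ y = π c • φ x) ∧
  (∀ (h : H) (x y : L), (y : V.carrier) = h • (x : V.carrier) → φ y = h • φ x) ∧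
  (∀ (i : ℤ) (x : L), (x : V.carrier) ∈ V.grading i → φ x ∈ Y.grading i) ∧
  (∀ i : ℤ, ∀ y ∈ Y.grading i, ∃ x : L, (x : V.carrier) ∈ V.grading i ∧ φ x = y)

end FieldCoeffs

section GenericLA

theorem charpoly_of_exact {F : Type*} [Field F] {X Y Z : Type*}
    [AddCommGroup X] [Module F X] [Module.Finite F X]
    [AddCommGroup Y] [Module F Y] [Module.Finite F Y]
    [AddCommGroup Z] [Module F Z] [Module.Finite F Z]
    (f : X →ₗ[F] Y) (g : Y →ₗ[F] Z) (hf : Injective f) (hg : Surjective g)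
    (hfg : ∀ y, g y = 0 ↔ ∃ x, f x = y)
    (a : Module.End F X) (b : Module.End F Y) (c : Module.End F Z)
    (hab : ∀ x, b (f x) = f (a x)) (hbc : ∀ y, g (b y) = c (g y)) :
    b.charpoly = a.charpoly * c.charpoly := by
  classical
  obtain ⟨s, hs⟩ := g.exists_rightInverse_of_surjective (LinearMap.range_eq_top.2 hg)
  have hs' : ∀ z, g (s z) = z := fun z => LinearMap.congr_fun hs z
  have hgf : ∀ x, g (f x) = 0 := fun x => (hfg _).2 ⟨x, rfl⟩
  let e0 : (X × Z) →ₗ[F] Y := f.coprod s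
  have he0 : ∀ x z, e0 (x, z) = f x + s z := fun x z => by simp [e0]
  have hbij : Bijective e0 := by
    constructor
    · rw [← LinearMap.ker_eq_bot, LinearMap.ker_eq_bot']
      rintro ⟨x, z⟩ h
      rw [he0] at h
      have hz : z = 0 := by
        have := congrArg g h
        simpa [hgf, hs'] using this
      subst hz
      have : f x = f 0 := by simpa using h
      rw [hf this]; rfl
    · intro y
      obtain ⟨x, hx⟩ := (hfg (y - s (g y))).1 (by simp [hs'])
      exact ⟨(x, g y), by rw [he0, hx]; abel⟩
  let e : (X × Z) ≃ₗ[F] Y := LinearEquiv.ofBijective e0 hbij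
  have he : ∀ x z, e (x, z) = f x + s z := he0
  rw [← LinearEquiv.charpoly_conj e.symm b]
  set φ : Module.End F (X × Z) := e.symm.conj b with hφ
  have h1 : ∀ x, φ (x, 0) = (a x, 0) := by
    intro x
    apply e.injective
    have h3 : e (φ (x, 0)) = b (e (x, 0)) := by simp [hφ, LinearEquiv.conj_apply]
    rw [h3, he, he]; simp [hab]
  have h2 : ∀ w, (φ w).2 = c w.2 := by
    intro w
    have : g (e (φ w)) = (φ w).2 := by
      rw [← Prod.mk.eta (p := φ w), he]; simp [hgf, hs']
    rw [← this]
    have h3 : e (φ w) = b (e w) := by simp [hφ, LinearEquiv.conj_apply]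
    rw [h3, hbc, ← Prod.mk.eta (p := w), he]; simp [hgf, hs']
  let bX := Module.Free.chooseBasis F X
  let bZ := Module.Free.chooseBasis F Z
  have hm : LinearMap.toMatrix (bX.prod bZ) (bX.prod bZ) φ = Matrix.fromBlocks
      (LinearMap.toMatrix bX bX a)
      (Matrix.of fun i j => bX.repr (φ (0, bZ j)).1 i) 0 (LinearMap.toMatrix bZ bZ c) := by
    ext u v
    rcases u with u | u <;> rcases v with v | v <;>
      simp [LinearMap.toMatrix_apply, h1, h2]
  rw [← LinearMap.charpoly_toMatrix φ (bX.prod bZ), hm, Matrix.charpoly_fromBlocks_zero₂₁,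
    LinearMap.charpoly_toMatrix, LinearMap.charpoly_toMatrix]

theorem charpoly_coeff_integral {A : Type*} [CommRing A] {K : Type*} [Field K] [Algebra A K]
    {V : Type*} [AddCommGroup V] [Module K V] [Module.Finite K V]
    (f : Module.End K V) (p : Polynomial A) (hp : p.Monic)
    (hf : Polynomial.aeval f (p.map (algebraMap A K)) = 0) (m : ℕ) :
    IsIntegral A (f.charpoly.coeff m) := by
  let Kb := AlgebraicClosure K
  refine (isIntegral_algHom_iff (IsScalarTower.toAlgHom A K Kb)
    (FaithfulSMul.algebraMap_injective K _)).mp ?_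
  rw [IsScalarTower.coe_toAlgHom', ← Polynomial.coeff_map]
  refine Polynomial.isIntegral_coeff_of_factors _
    (by simp [(f.charpoly_monic).map, isIntegral_one]) (IsAlgClosed.splits _) ?_ m
  intro x hx
  rw [← LinearMap.charpoly_baseChange] at hx
  have hx' := (Module.End.hasEigenvalue_iff_isRoot_charpoly _ _).2 hx
  obtain ⟨v, hv⟩ := hx'.exists_hasEigenvector
  refine ⟨p, hp, ?_⟩
  have h1 := Module.End.aeval_apply_of_hasEigenvector (p := p.map (algebraMap A Kb)) hv
  have h2 : Polynomial.aeval (f.baseChange Kb) (p.map (algebraMap A Kb)) = 0 := by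
    have h3 : Polynomial.aeval (f.baseChange Kb) (p.map (algebraMap A K)) = 0 := by
      have := Polynomial.aeval_algHom_apply (Module.End.baseChangeHom K Kb V) f
        (p.map (algebraMap A K))
      rw [hf, map_zero] at this
      exact this
    rw [IsScalarTower.algebraMap_eq A K Kb, ← Polynomial.map_map, Polynomial.aeval_map_algebraMap]
    exact h3
  rw [h2, LinearMap.zero_apply] at h1
  have := (smul_eq_zero.1 h1.symm).resolve_right hv.2
  rwa [Polynomial.eval_map] at this

end GenericLA

section GradedHelpers

variable {A : Type u} [CommRing A] {H : Type u} [Ring H] [Algebra A H]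
  {𝒜 : ℤ → Submodule A H} {S : Type u} [CommRing S] [Algebra A S]

namespace GrMod

/-- Projection onto the degree `i` piece. -/
noncomputable def pr (V : GrMod A H 𝒜 S) (i : ℤ) : V.carrier →ₗ[S] V.carrier where
  toFun x := (DirectSum.decompose V.grading x i : V.grading i)
  map_add' x y := by simp [DirectSum.decompose_add]
  map_smul' s x := by rw [DirectSum.decompose_smul]; rfl

theorem pr_mem (V : GrMod A H 𝒜 S) (i : ℤ) (x : V.carrier) : V.pr i x ∈ V.grading i :=
  (DirectSum.decompose V.grading x i).2

theorem pr_same (V : GrMod A H 𝒜 S) {i : ℤ} {x : V.carrier} (hx : x ∈ V.grading i) :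
    V.pr i x = x := DirectSum.decompose_of_mem_same _ hx

theorem pr_ne (V : GrMod A H 𝒜 S) {i j : ℤ} {x : V.carrier} (hx : x ∈ V.grading j)
    (h : j ≠ i) : V.pr i x = 0 := DirectSum.decompose_of_mem_ne _ hx h

theorem eq_sum_pr (V : GrMod A H 𝒜 S) (x : V.carrier) :
    ∃ s : Finset ℤ, x = ∑ i ∈ s, V.pr i x := by
  classical
  exact ⟨_, (DirectSum.sum_support_decompose V.grading x).symm⟩

theorem eq_zero_of_pr (V : GrMod A H 𝒜 S) {x : V.carrier} (h : ∀ i, V.pr i x = 0) : x = 0 := by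
  obtain ⟨s, hs⟩ := V.eq_sum_pr x
  rw [hs]; exact Finset.sum_eq_zero fun i _ => h i

theorem pr_smul_hom (V : GrMod A H 𝒜 S) (i k : ℤ) (h : H) (hh : h ∈ 𝒜 k) (x : V.carrier) :
    V.pr i (h • x) = h • V.pr (i - k) x := by
  induction x using DirectSum.Decomposition.inductionOn V.grading with
  | zero => simp
  | @homogeneous j m =>
    have h1 := V.grading_smul k j h hh m m.2
    by_cases hj : j = i - k
    · rw [pr_same V (by convert h1 using 2; omega), pr_same V (by convert m.2 using 2; omega)]
    · rw [pr_ne V h1 (by omega), pr_ne V m.2 hj, smul_zero]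
  | add a b ha hb => simp [smul_add, ha, hb]

variable [GradedAlgebra 𝒜]

theorem pr_smul_of_mem (V : GrMod A H 𝒜 S) (i j : ℤ) (h : H) (y : V.carrier)
    (hy : y ∈ V.grading j) :
    V.pr i (h • y) = ((DirectSum.decompose 𝒜 h (i - j) : 𝒜 (i - j)) : H) • y := by
  induction h using DirectSum.Decomposition.inductionOn 𝒜 with
  | zero => simp
  | @homogeneous k m =>
    rw [pr_smul_hom V i k _ m.2]
    by_cases hj : k = i - j
    · rw [pr_same V (by convert hy using 2; omega), DirectSum.decompose_of_mem_same _
        (by convert m.2 using 2; omega)]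
    · rw [pr_ne V hy (by omega), DirectSum.decompose_of_mem_ne _ m.2 hj]; simp
  | add a b ha hb => simp [add_smul, ha, hb, DirectSum.decompose_add]

theorem pr_smul_pr (V : GrMod A H 𝒜 S) (i j : ℤ) (h : H) (x : V.carrier) :
    V.pr i (h • V.pr j x) =
      V.pr i (((DirectSum.decompose 𝒜 h (i - j) : 𝒜 (i - j)) : H) • x) := by
  rw [pr_smul_of_mem V i j h _ (V.pr_mem j x), pr_smul_hom V i (i - j) _
    (DirectSum.decompose 𝒜 h (i - j)).2]
  congr 2; congr 1; omega

end GrMod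

/-- Decomposition from a family of projections. -/
theorem isInternal_of_proj {S M : Type*} [CommRing S] [AddCommGroup M] [Module S M]
    (g : ℤ → Submodule S M) (π : ℤ → M →ₗ[S] M)
    (hs : ∀ i, ∀ x ∈ g i, π i x = x) (hn : ∀ i j, j ≠ i → ∀ x ∈ g j, π i x = 0)
    (ht : ⨆ i, g i = ⊤) : DirectSum.IsInternal g := by
  rw [DirectSum.isInternal_submodule_iff_iSupIndep_and_iSup_eq_top]
  refine ⟨?_, ht⟩
  intro i
  rw [Submodule.disjoint_def]
  intro x hx hx'
  rw [← hs i x hx]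
  have : (⨆ j, ⨆ (_ : j ≠ i), g j) ≤ LinearMap.ker (π i) :=
    iSup_le fun j => iSup_le fun hj => fun y hy => hn i j hj y hy
  exact this hx'

namespace GrMod

/-- An `S`-submodule which is `H`-stable and graded. -/
structure GSub (V : GrMod A H 𝒜 S) where
  P : Submodule S V.carrier
  smul : ∀ (h : H), ∀ x ∈ P, h • x ∈ P
  pr : ∀ x ∈ P, ∀ i, V.pr i x ∈ P

/-- Action on the submodule. -/
@[reducible]
def GSub.modH {V : GrMod A H 𝒜 S} (G : V.GSub) : Module H G.P :=
  letI : SMul H G.P := ⟨fun h x => ⟨h • (x : V.carrier), G.smul h x x.2⟩⟩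
  Function.Injective.module H G.P.subtype.toAddMonoidHom Subtype.val_injective (fun _ _ => rfl)

/-- Action on the quotient. -/
@[reducible]
noncomputable def GSub.modHQ {V : GrMod A H 𝒜 S} (G : V.GSub) : Module H (V.carrier ⧸ G.P) :=
  letI : SMul H (V.carrier ⧸ G.P) :=
    ⟨fun h => G.P.mapQ G.P (V.forget.act h) (fun x hx => G.smul h x hx)⟩
  Function.Surjective.module H G.P.mkQ.toAddMonoidHom G.P.mkQ_surjective (fun _ _ => rfl)

theorem iSup_grading (V : GrMod A H 𝒜 S) : ⨆ i, V.grading i = ⊤ := by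
  rw [eq_top_iff]
  intro x _
  obtain ⟨s, hs⟩ := V.eq_sum_pr x
  rw [hs]
  exact Submodule.sum_mem _ fun i _ => Submodule.mem_iSup_of_mem i (V.pr_mem i x)

theorem GSub.internal {V : GrMod A H 𝒜 S} (G : V.GSub) :
    DirectSum.IsInternal fun i => (V.grading i).comap G.P.subtype := by
  refine isInternal_of_proj _ (fun i => (V.pr i).restrict (fun x hx => G.pr x hx i)) ?_ ?_ ?_
  · intro i x hx; exact Subtype.ext (V.pr_same hx)
  · intro i j hj x hx; exact Subtype.ext (V.pr_ne hx hj)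
  · rw [eq_top_iff]
    intro x _
    obtain ⟨s, hs⟩ := V.eq_sum_pr (x : V.carrier)
    have : x = ∑ i ∈ s, (⟨V.pr i x, G.pr x x.2 i⟩ : G.P) := by
      apply Subtype.ext; simpa using hs
    rw [this]
    exact Submodule.sum_mem _ fun i _ => Submodule.mem_iSup_of_mem i (V.pr_mem i x)

theorem GSub.internalQ {V : GrMod A H 𝒜 S} (G : V.GSub) :
    DirectSum.IsInternal fun i => (V.grading i).map G.P.mkQ := by
  refine isInternal_of_proj _ (fun i => G.P.mapQ G.P (V.pr i) (fun x hx => G.pr x hx i)) ?_ ?_ ?_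
  · rintro i _ ⟨x, hx, rfl⟩
    simp [V.pr_same hx]
  · rintro i j hj _ ⟨x, hx, rfl⟩
    simp [V.pr_ne hx hj]
  · rw [← Submodule.map_iSup, V.iSup_grading, Submodule.map_top, Submodule.range_mkQ]

end GrMod
end GradedHelpers

section FieldHelpers

variable {A : Type u} [CommRing A] {H : Type u} [Ring H] [Algebra A H]
  {𝒜 : ℤ → Submodule A H} {F : Type u} [Field F] [Algebra A F]

namespace GrMod

/-- The graded submodule as a graded module. -/
noncomputable def GSub.sub {V : GrMod A H 𝒜 F} (G : V.GSub) : GrMod A H 𝒜 F :=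
  letI := G.modH
  letI := G.internal.chooseDecomposition
  { carrier := G.P
    smul_comm' := fun h s x => Subtype.ext (V.smul_comm' h s x)
    compat := fun a x => Subtype.ext (V.compat a x)
    grading := fun i => (V.grading i).comap G.P.subtype
    grading_smul := fun i j h hh x hx => V.grading_smul i j h hh x hx }

/-- The quotient by a graded submodule as a graded module. -/
noncomputable def GSub.quot {V : GrMod A H 𝒜 F} (G : V.GSub) : GrMod A H 𝒜 F :=
  letI := G.modHQ
  letI := G.internalQ.chooseDecomposition
  { carrier := V.carrier ⧸ G.P
    smul_comm' := fun h s x => by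
      obtain ⟨x, rfl⟩ := G.P.mkQ_surjective x
      exact congrArg G.P.mkQ (V.smul_comm' h s x)
    compat := fun a x => by
      obtain ⟨x, rfl⟩ := G.P.mkQ_surjective x
      exact congrArg G.P.mkQ (V.compat a x)
    grading := fun i => (V.grading i).map G.P.mkQ
    grading_smul := by
      rintro i j h hh _ ⟨x, hx, rfl⟩
      exact ⟨h • x, V.grading_smul i j h hh x hx, rfl⟩ }

/-- The tautological exact sequence. -/
noncomputable def GSub.ses {V : GrMod A H 𝒜 F} (G : V.GSub) : GrSES G.sub V G.quot where
  f := G.P.subtype.toAddMonoidHom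
  g := G.P.mkQ.toAddMonoidHom
  f_smulS _ _ := rfl
  f_smulH _ _ := rfl
  g_smulS _ _ := rfl
  g_smulH _ _ := rfl
  inj := Subtype.val_injective
  surj := G.P.mkQ_surjective
  exact y := by
    constructor
    · intro h
      exact ⟨⟨y, (Submodule.Quotient.mk_eq_zero _).1 h⟩, rfl⟩
    · rintro ⟨x, rfl⟩
      exact (Submodule.Quotient.mk_eq_zero _).2 x.2
  f_graded i x hx := hx
  g_graded i y hy := ⟨y, hy, rfl⟩

theorem graded_pr {X Y : GrMod A H 𝒜 F} (f : X.carrier →+ Y.carrier)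
    (hf : ∀ (i : ℤ), ∀ x ∈ X.grading i, f x ∈ Y.grading i) (i : ℤ) (x : X.carrier) :
    f (X.pr i x) = Y.pr i (f x) := by
  induction x using DirectSum.Decomposition.inductionOn X.grading with
  | zero => simp
  | @homogeneous j m =>
    by_cases hj : j = i
    · subst hj
      rw [X.pr_same m.2, Y.pr_same (hf _ _ m.2)]
    · rw [X.pr_ne m.2 hj, Y.pr_ne (hf _ _ m.2) hj, map_zero]
  | add a b ha hb => simp [ha, hb]

theorem cpoly_ses {X Y Z : GrMod A H 𝒜 F} (E : GrSES X Y Z) (h : 𝒜 0) (i : ℤ) :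
    Y.cpoly h i = X.cpoly h i * Z.cpoly h i := by
  let f0 : X.carrier →ₗ[F] Y.carrier := { E.f with map_smul' := E.f_smulS }
  let g0 : Y.carrier →ₗ[F] Z.carrier := { E.g with map_smul' := E.g_smulS }
  let f : X.grading i →ₗ[F] Y.grading i := f0.restrict (E.f_graded i)
  let g : Y.grading i →ₗ[F] Z.grading i := g0.restrict (E.g_graded i)
  refine charpoly_of_exact f g ?_ ?_ ?_ (X.degAct h i) (Y.degAct h i) (Z.degAct h i) ?_ ?_
  · intro a b hab
    exact Subtype.ext (E.inj (congrArg Subtype.val hab))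
  · rintro ⟨z, hz⟩
    obtain ⟨y, rfl⟩ := E.surj z
    refine ⟨⟨Y.pr i y, Y.pr_mem i y⟩, Subtype.ext ?_⟩
    change E.g (Y.pr i y) = E.g y
    rw [graded_pr E.g E.g_graded, Z.pr_same hz]
  · intro y
    constructor
    · intro hy
      obtain ⟨x, hx⟩ := (E.exact y).1 (congrArg Subtype.val hy)
      refine ⟨⟨X.pr i x, X.pr_mem i x⟩, Subtype.ext ?_⟩
      change E.f (X.pr i x) = y
      rw [graded_pr E.f E.f_graded, hx, Y.pr_same y.2]
    · rintro ⟨x, rfl⟩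
      exact Subtype.ext ((E.exact _).2 ⟨x, rfl⟩)
  · intro x; exact Subtype.ext (E.f_smulH _ _).symm
  · intro y; exact Subtype.ext (E.g_smulH _ _)

theorem cls_ses {X Y Z : GrMod A H 𝒜 F} (E : GrSES X Y Z) : Y.cls = X.cls + Z.cls := by
  have h : FreeAbelianGroup.of Y - FreeAbelianGroup.of X - FreeAbelianGroup.of Z ∈
      AddSubgroup.closure (grRelSet A H 𝒜 F) :=
    AddSubgroup.subset_closure ⟨X, Y, Z, ⟨E⟩, rfl⟩
  have h2 := (QuotientAddGroup.eq_zero_iff _).2 h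
  have h3 : Y.cls - X.cls - Z.cls = 0 := h2
  rw [sub_sub, sub_eq_zero] at h3
  exact h3

theorem cls_zero (Z : GrMod A H 𝒜 F) [Subsingleton Z.carrier] : Z.cls = 0 := by
  have E : GrSES Z Z Z :=
    { f := 0, g := 0
      f_smulS := fun _ _ => Subsingleton.elim _ _
      f_smulH := fun _ _ => Subsingleton.elim _ _
      g_smulS := fun _ _ => Subsingleton.elim _ _
      g_smulH := fun _ _ => Subsingleton.elim _ _
      inj := fun _ _ _ => Subsingleton.elim _ _
      surj := fun y => ⟨0, Subsingleton.elim _ _⟩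
      exact := fun y => ⟨fun _ => ⟨0, Subsingleton.elim _ _⟩, fun _ => Subsingleton.elim _ _⟩
      f_graded := fun _ _ _ => Submodule.zero_mem _
      g_graded := fun _ _ _ => Submodule.zero_mem _ }
  have := cls_ses E
  simpa using this

theorem cpoly_zero (Z : GrMod A H 𝒜 F) [Subsingleton Z.carrier] (h : 𝒜 0) (i : ℤ) :
    Z.cpoly h i = 1 := by
  have hm : (Z.cpoly h i).Monic := LinearMap.charpoly_monic _
  apply hm.natDegree_eq_zero.1
  rw [cpoly, LinearMap.charpoly_natDegree]
  exact Module.finrank_zero_of_subsingleton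

/-- The full graded submodule. -/
def topG (V : GrMod A H 𝒜 F) : V.GSub := ⟨⊤, fun _ _ _ => trivial, fun _ _ _ => trivial⟩

theorem iso_ses {M N : GrMod A H 𝒜 F} (h : M.GrIso N) : Nonempty (GrSES M N N.topG.quot) := by
  obtain ⟨e, h1, h2, h3⟩ := h
  have : Subsingleton N.topG.quot.carrier :=
    inferInstanceAs (Subsingleton (N.carrier ⧸ (⊤ : Submodule F N.carrier)))
  exact ⟨{ f := e.toAddMonoidHom
           g := 0
           f_smulS := h1
           f_smulH := h2
           g_smulS := fun _ _ => Subsingleton.elim _ _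
           g_smulH := fun _ _ => Subsingleton.elim _ _
           inj := e.injective
           surj := fun _ => ⟨0, Subsingleton.elim _ _⟩
           exact := fun y => ⟨fun _ => e.surjective y, fun _ => Subsingleton.elim _ _⟩
           f_graded := h3
           g_graded := fun _ _ _ => Submodule.zero_mem _ }⟩

theorem iso_cls {M N : GrMod A H 𝒜 F} (h : M.GrIso N) : M.cls = N.cls := by
  have : Subsingleton N.topG.quot.carrier :=
    inferInstanceAs (Subsingleton (N.carrier ⧸ (⊤ : Submodule F N.carrier)))
  obtain ⟨E⟩ := iso_ses h
  rw [cls_ses E, cls_zero N.topG.quot, add_zero]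

theorem iso_cpoly {M N : GrMod A H 𝒜 F} (hi : M.GrIso N) (h : 𝒜 0) (i : ℤ) :
    M.cpoly h i = N.cpoly h i := by
  have : Subsingleton N.topG.quot.carrier :=
    inferInstanceAs (Subsingleton (N.carrier ⧸ (⊤ : Submodule F N.carrier)))
  obtain ⟨E⟩ := iso_ses hi
  rw [cpoly_ses E, cpoly_zero N.topG.quot, mul_one]

theorem exists_list (n : ℕ) : ∀ V : GrMod A H 𝒜 F, Module.finrank F V.carrier = n →
    ∃ l : List (GrMod A H 𝒜 F), (∀ M ∈ l, M.GrSimple) ∧ V.cls = (l.map cls).sum ∧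
      ∀ h i, V.cpoly h i = (l.map fun M => M.cpoly h i).prod := by
  induction n using Nat.strong_induction_on with
  | _ n ih =>
  intro V hV
  by_cases h0 : Subsingleton V.carrier
  · exact ⟨[], by simp, by simp [cls_zero V], by simp [cpoly_zero V]⟩
  by_cases hs : V.GrSimple
  · exact ⟨[V], by simpa using hs, by simp, by simp⟩
  rw [not_subsingleton_iff_nontrivial] at h0
  have : ∃ p : AddSubgroup V.carrier, V.IsGrSub p ∧ p ≠ ⊥ ∧ p ≠ ⊤ := by
    by_contra hc
    push Not at hc
    exact hs ⟨h0, fun p hp => or_iff_not_imp_left.2 (hc p hp)⟩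
  obtain ⟨p, hp, hb, ht⟩ := this
  let G : V.GSub := ⟨{ p with smul_mem' := fun c x hx => hp.1.1 c x hx }, hp.1.2, hp.2⟩
  have hGt : G.P ≠ ⊤ := by
    intro h; apply ht; rw [eq_top_iff]; intro x _
    have : x ∈ G.P := by rw [h]; trivial
    exact this
  have hGb : G.P ≠ ⊥ := by
    intro h; apply hb; rw [eq_bot_iff]; intro x hx
    have : x ∈ G.P := hx
    rw [h] at this; exact this
  have e1 : Module.finrank F G.sub.carrier = Module.finrank F G.P := rfl
  have e2 : Module.finrank F G.quot.carrier = Module.finrank F (V.carrier ⧸ G.P) := rfl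
  have e3 := Submodule.finrank_quotient_add_finrank G.P
  have e4 := Submodule.finrank_lt hGt
  have e5 : 0 < Module.finrank F G.P := by
    rw [pos_iff_ne_zero]; intro h; exact hGb (Submodule.finrank_eq_zero.1 h)
  obtain ⟨l1, a1, b1, c1⟩ := ih _ (by omega) G.sub rfl
  obtain ⟨l2, a2, b2, c2⟩ := ih _ (by omega) G.quot rfl
  refine ⟨l1 ++ l2, ?_, ?_, ?_⟩
  · intro M hM
    rcases List.mem_append.1 hM with h | h
    · exact a1 M h
    · exact a2 M h
  · rw [cls_ses G.ses, b1, b2]; simp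
  · intro h i; rw [cpoly_ses G.ses, c1, c2]; simp

end GrMod

end FieldHelpers

section SimpleHelpers

theorem density_sep {R F S ι : Type*} [Ring R] [Field F] [Algebra F R]
    [AddCommGroup S] [Module R S] [Module F S] [Module.Finite F S]
    [Fintype ι] [DecidableEq ι] (T : ι → Type*) [∀ j, AddCommGroup (T j)]
    [∀ j, Module R (T j)] [∀ j, Module F (T j)] [∀ j, Module.Finite F (T j)]
    (cS : ∀ (c : F) (x : S), algebraMap F R c • x = c • x)
    (cT : ∀ j (c : F) (x : T j), algebraMap F R c • x = c • x)
    [IsSemisimpleModule R S] [∀ j, IsSemisimpleModule R (T j)]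
    (out : ∀ j (f : S →ₗ[R] T j), f = 0) (inn : ∀ j (f : T j →ₗ[R] S), f = 0) :
    ∃ r : R, (∀ x : S, r • x = x) ∧ ∀ j (x : T j), r • x = 0 := by
  have outP : ∀ f : S →ₗ[R] (∀ j, T j), f = 0 := by
    intro f
    apply LinearMap.ext; intro x; funext j
    exact LinearMap.congr_fun (out j ((LinearMap.proj j).comp f)) x
  have innP : ∀ f : (∀ j, T j) →ₗ[R] S, f = 0 := by
    intro f
    apply LinearMap.pi_ext'
    intro j
    rw [inn j (f.comp (LinearMap.single R T j))]; rfl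
  let f : Module.End (Module.End R (S × ∀ j, T j)) (S × ∀ j, T j) :=
    { toFun := fun w => (w.1, 0)
      map_add' := fun a b => by
        refine Prod.ext rfl ?_
        exact (add_zero (0 : ∀ j, T j)).symm
      map_smul' := by
        intro g w
        have h1 : ∀ x : S, (g (x, 0)).2 = 0 := fun x =>
          LinearMap.congr_fun (outP ((LinearMap.snd R _ _).comp
            (g.comp (LinearMap.inl R _ _)))) x
        have h2 : ∀ y, (g (0, y)).1 = 0 := fun y =>
          LinearMap.congr_fun (innP ((LinearMap.fst R _ _).comp
            (g.comp (LinearMap.inr R _ _)))) y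
        have h3 : g w = g (w.1, 0) + g (0, w.2) := by
          rw [← map_add]; simp
        change ((g w).1, (0 : ∀ j, T j)) = g (w.1, 0)
        rw [h3]
        refine Prod.ext ?_ ?_
        · simp [h2]
        · simp [h1] }
  have hss : IsSemisimpleModule R (S × ∀ j, T j) := by
    have h1 := IsSemisimpleModule.sup
      (IsSemisimpleModule.range (LinearMap.inl R S (∀ j, T j)))
      (IsSemisimpleModule.range (LinearMap.inr R S (∀ j, T j)))
    rw [LinearMap.sup_range_inl_inr] at h1
    exact IsSemisimpleModule.congr Submodule.topEquiv.symm
  obtain ⟨s, hs⟩ := Module.Finite.fg_top (R := F) (M := S × ∀ j, T j)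
  obtain ⟨r, hr⟩ := jacobson_density (R := R) (M := S × ∀ j, T j) f s
  have hsc : ∀ (c : F) (w : S × ∀ j, T j), algebraMap F R c • w = c • w := by
    intro c w
    refine Prod.ext ?_ ?_
    · exact cS _ _
    · funext j; exact cT _ _ _
  have hr' : ∀ w : S × ∀ j, T j, f w = r • w := by
    intro w
    have : w ∈ Submodule.span F (s : Set (S × ∀ j, T j)) := by rw [hs]; trivial
    induction this using Submodule.span_induction with
    | mem w hw => exact hr w hw
    | zero => simp
    | add a b _ _ ha hb => rw [map_add, ha, hb, smul_add]
    | smul c w _ hw =>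
      have e1 : r • (c • w) = c • (r • w) := by
        rw [← hsc c w, smul_smul, ← Algebra.commutes c r, ← smul_smul, hsc]
      rw [e1, ← hw]
      refine Prod.ext rfl ?_
      exact (smul_zero c).symm
  refine ⟨r, fun x => (congrArg Prod.fst (hr' (x, 0))).symm, fun j x => ?_⟩
  have h1 := congrArg Prod.snd (hr' (0, Pi.single j x))
  have h2 := congrFun h1 j
  have h3 : (0 : T j) = r • (Pi.single j x : ∀ j, T j) j := h2
  rw [Pi.single_eq_same] at h3
  exact h3.symm

variable {A : Type u} [CommRing A] {H : Type u} [Ring H] [Algebra A H]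
  {𝒜 : ℤ → Submodule A H} [GradedAlgebra 𝒜] {F : Type u} [Field F] [Algebra A F]

namespace GrMod

theorem pr_smul_self (V : GrMod A H 𝒜 F) (i : ℤ) (h : H) (y : V.carrier)
    (hy : y ∈ V.grading i) :
    V.pr i (h • y) = ((DirectSum.decompose 𝒜 h 0 : 𝒜 0) : H) • y := by
  have := pr_smul_of_mem V i i h y hy
  rwa [sub_self] at this

/-- The largest graded submodule whose degree-`i` part lies in `N`. -/
noncomputable def core (V : GrMod A H 𝒜 F) (i : ℤ) (N : Submodule F V.carrier) :
    AddSubgroup V.carrier where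
  carrier := { x | ∀ h : H, V.pr i (h • x) ∈ N }
  zero_mem' h := by simp
  add_mem' {a b} ha hb h := by
    rw [smul_add, map_add]; exact N.add_mem (ha h) (hb h)
  neg_mem' {a} ha h := by
    rw [smul_neg, map_neg]; exact N.neg_mem (ha h)

theorem core_isGrSub (V : GrMod A H 𝒜 F) (i : ℤ) (N : Submodule F V.carrier) :
    V.IsGrSub (V.core i N) := by
  refine ⟨⟨?_, ?_⟩, ?_⟩
  · intro s x hx h
    have e : V.pr i (h • (s • (show V.carrier from x))) ∈ N := by
      rw [V.smul_comm', (V.pr i).map_smul]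
      exact N.smul_mem _ (hx h)
    exact e
  · intro k x hx h
    have e : V.pr i (h • (k • (show V.carrier from x))) ∈ N := by
      rw [← mul_smul]; exact hx _
    exact e
  · intro x hx j h
    change V.pr i (h • V.pr j x) ∈ N
    rw [pr_smul_pr]; exact hx _

theorem core_bot (V : GrMod A H 𝒜 F) (hV : V.GrSimple) (i : ℤ) (z : V.carrier)
    (hz : z ∈ V.grading i) (hz0 : z ≠ 0) (x : V.carrier) (hx : ∀ h : H, V.pr i (h • x) = 0) :
    x = 0 := by
  have hx' : x ∈ V.core i ⊥ := fun h => hx h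
  rcases hV.2 _ (V.core_isGrSub i ⊥) with h | h
  · rw [h] at hx'; exact hx'
  · have : z ∈ V.core i ⊥ := by rw [h]; trivial
    have := this 1
    rw [one_smul, V.pr_same hz] at this
    exact absurd this hz0

theorem iso_of_deg {M N : GrMod A H 𝒜 F} (hM : M.GrSimple) (hN : N.GrSimple) (i : ℤ)
    (φ : M.grading i ≃ₗ[F] N.grading i)
    (hφ : ∀ (h : 𝒜 0) x, φ (M.degAct h i x) = N.degAct h i (φ x))
    (z : M.grading i) (hz : z ≠ 0) : M.GrIso N := by
  let pM : M.carrier →ₗ[F] M.grading i := (M.pr i).codRestrict _ (M.pr_mem i)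
  let pN : N.carrier →ₗ[F] N.grading i := (N.pr i).codRestrict _ (N.pr_mem i)
  have hpM : ∀ x, (pM x : M.carrier) = M.pr i x := fun _ => rfl
  have hpN : ∀ x, (pN x : N.carrier) = N.pr i x := fun _ => rfl
  let rel : M.carrier → N.carrier → Prop := fun x y => ∀ h : H, φ (pM (h • x)) = pN (h • y)
  have rel_add : ∀ {x y x' y'}, rel x y → rel x' y' → rel (x + x') (y + y') := by
    intro x y x' y' h1 h2 h
    rw [smul_add, smul_add, map_add, map_add, map_add, h1 h, h2 h]
  have rel_neg : ∀ {x y}, rel x y → rel (-x) (-y) := by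
    intro x y h1 h
    rw [smul_neg, smul_neg, map_neg, map_neg, map_neg, h1 h]
  have rel_smul : ∀ (s : F) {x y}, rel x y → rel (s • x) (s • y) := by
    intro s x y h1 h
    rw [M.smul_comm', N.smul_comm', pM.map_smul, pN.map_smul, φ.map_smul, h1 h]
  have rel_H : ∀ (k : H) {x y}, rel x y → rel (k • x) (k • y) := by
    intro s x y h1 h
    rw [← mul_smul, ← mul_smul]; exact h1 _
  have rel_pr : ∀ (j : ℤ) {x y}, rel x y → rel (M.pr j x) (N.pr j y) := by
    intro j x y h1 h
    have e1 : pM (h • M.pr j x) =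
        pM (((DirectSum.decompose 𝒜 h (i - j) : 𝒜 (i - j)) : H) • x) :=
      Subtype.ext (M.pr_smul_pr i j h x)
    have e2 : pN (h • N.pr j y) =
        pN (((DirectSum.decompose 𝒜 h (i - j) : 𝒜 (i - j)) : H) • y) :=
      Subtype.ext (N.pr_smul_pr i j h y)
    rw [e1, e2]; exact h1 _
  have rel_φ : ∀ x : M.grading i, rel x (φ x : N.grading i) := by
    intro x h
    have e1 : pM (h • (x : M.carrier)) = M.degAct (DirectSum.decompose 𝒜 h 0) i x :=
      Subtype.ext (M.pr_smul_self i h x x.2)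
    have e2 : pN (h • ((φ x : N.grading i) : N.carrier)) =
        N.degAct (DirectSum.decompose 𝒜 h 0) i (φ x) :=
      Subtype.ext (N.pr_smul_self i h _ (φ x).2)
    rw [e1, e2, hφ]
  have hz' : (z : M.carrier) ≠ 0 := fun h => hz (Subtype.ext h)
  have hφz : ((φ z : N.grading i) : N.carrier) ≠ 0 := by
    intro h
    apply hz
    apply φ.injective
    rw [map_zero]; exact Subtype.ext h
  have rel0 : ∀ y, rel 0 y → y = 0 := by
    intro y hy
    refine N.core_bot hN i _ (φ z).2 hφz y fun h => ?_
    rw [← hpN, ← hy h]; simp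
  have rel0' : ∀ x, rel x 0 → x = 0 := by
    intro x hx
    refine M.core_bot hM i _ z.2 hz' x fun h => ?_
    have := hx h
    rw [smul_zero, map_zero, LinearEquiv.map_eq_zero_iff] at this
    rw [← hpM, this]; rfl
  have rel_uniq : ∀ x y y', rel x y → rel x y' → y = y' := by
    intro x y y' h1 h2
    have := rel_add h1 (rel_neg h2)
    rw [add_neg_cancel] at this
    have := rel0 _ this
    rwa [← sub_eq_add_neg, sub_eq_zero] at this
  have rel_uniq' : ∀ x x' y, rel x y → rel x' y → x = x' := by
    intro x y y' h1 h2
    have := rel_add h1 (rel_neg h2)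
    rw [add_neg_cancel] at this
    have := rel0' _ this
    rwa [← sub_eq_add_neg, sub_eq_zero] at this
  have rel00 : rel 0 0 := by intro h; simp
  have tot : ∀ x, ∃ y, rel x y := by
    let p : AddSubgroup M.carrier :=
      { carrier := { x | ∃ y, rel x y }
        zero_mem' := ⟨0, rel00⟩
        add_mem' := by rintro a b ⟨y, h⟩ ⟨y', h'⟩; exact ⟨_, rel_add h h'⟩
        neg_mem' := by rintro a ⟨y, h⟩; exact ⟨_, rel_neg h⟩ }
    have hp : M.IsGrSub p := by
      refine ⟨⟨?_, ?_⟩, ?_⟩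
      · rintro s x ⟨y, h⟩; exact ⟨_, rel_smul s h⟩
      · rintro s x ⟨y, h⟩; exact ⟨_, rel_H s h⟩
      · rintro x ⟨y, h⟩ j; exact ⟨_, rel_pr j h⟩
    rcases hM.2 p hp with h | h
    · have : (z : M.carrier) ∈ p := ⟨_, rel_φ z⟩
      rw [h] at this
      exact absurd this hz'
    · intro x
      have : x ∈ p := by rw [h]; trivial
      exact this
  have tot' : ∀ y, ∃ x, rel x y := by
    let p : AddSubgroup N.carrier :=
      { carrier := { y | ∃ x, rel x y }
        zero_mem' := ⟨0, rel00⟩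
        add_mem' := by rintro a b ⟨y, h⟩ ⟨y', h'⟩; exact ⟨_, rel_add h h'⟩
        neg_mem' := by rintro a ⟨y, h⟩; exact ⟨_, rel_neg h⟩ }
    have hp : N.IsGrSub p := by
      refine ⟨⟨?_, ?_⟩, ?_⟩
      · rintro s x ⟨y, h⟩; exact ⟨_, rel_smul s h⟩
      · rintro s x ⟨y, h⟩; exact ⟨_, rel_H s h⟩
      · rintro x ⟨y, h⟩ j; exact ⟨_, rel_pr j h⟩
    rcases hN.2 p hp with h | h
    · have : ((φ z : N.grading i) : N.carrier) ∈ p := ⟨_, rel_φ z⟩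
      rw [h] at this
      exact absurd this hφz
    · intro x
      have : x ∈ p := by rw [h]; trivial
      exact this
  choose u hu using tot
  choose v hv using tot'
  refine ⟨{ toFun := u
            invFun := v
            left_inv := fun x => rel_uniq' _ _ _ (hv _) (hu x)
            right_inv := fun y => rel_uniq _ _ _ (hu _) (hv y)
            map_add' := fun x x' => rel_uniq _ _ _ (hu _) (rel_add (hu x) (hu x')) }, ?_, ?_, ?_⟩
  · intro s x; exact rel_uniq _ _ _ (hu _) (rel_smul s (hu x))
  · intro s x; exact rel_uniq _ _ _ (hu _) (rel_H s (hu x))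
  · intro j x hx
    change u x ∈ N.grading j
    have h1 := rel_pr j (hu x)
    rw [M.pr_same hx] at h1
    rw [rel_uniq _ _ _ (hu x) h1]
    exact N.pr_mem _ _

/-- The action of the free algebra on `H₀` on the degree-`i` piece. -/
noncomputable def rep (V : GrMod A H 𝒜 F) (i : ℤ) :
    FreeAlgebra F (𝒜 0) →ₐ[F] Module.End F (V.grading i) :=
  FreeAlgebra.lift F (fun h => V.degAct h i)

/-- Module structure of the degree-`i` piece over the free algebra on `H₀`. -/
@[reducible]
noncomputable def repMod (V : GrMod A H 𝒜 F) (i : ℤ) :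
    Module (FreeAlgebra F (𝒜 0)) (V.grading i) :=
  Module.compHom _ (V.rep i).toRingHom

attribute [local instance] GrMod.repMod

theorem rep_smul (V : GrMod A H 𝒜 F) (i : ℤ) (r : FreeAlgebra F (𝒜 0)) (x : V.grading i) :
    r • x = V.rep i r x := rfl

theorem rep_ι (V : GrMod A H 𝒜 F) (i : ℤ) (h : 𝒜 0) (x : V.grading i) :
    FreeAlgebra.ι F h • x = V.degAct h i x := by
  rw [rep_smul, rep, FreeAlgebra.lift_ι_apply]

theorem rep_alg (V : GrMod A H 𝒜 F) (i : ℤ) (c : F) (x : V.grading i) :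
    algebraMap F (FreeAlgebra F (𝒜 0)) c • x = c • x := by
  rw [rep_smul, AlgHom.commutes]; rfl

theorem rep_simple (V : GrMod A H 𝒜 F) (hV : V.GrSimple) (i : ℤ) [Nontrivial (V.grading i)] :
    IsSimpleModule (FreeAlgebra F (𝒜 0)) (V.grading i) := by
  rw [isSimpleModule_iff]
  refine { eq_bot_or_eq_top := fun N => ?_ }
  let N' : Submodule F V.carrier :=
    { carrier := { x | ∃ hx : x ∈ V.grading i, (⟨x, hx⟩ : V.grading i) ∈ N }
      zero_mem' := ⟨Submodule.zero_mem _, N.zero_mem⟩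
      add_mem' := by
        rintro a b ⟨h1, h2⟩ ⟨h3, h4⟩
        exact ⟨Submodule.add_mem _ h1 h3, N.add_mem h2 h4⟩
      smul_mem' := by
        rintro c x ⟨h1, h2⟩
        refine ⟨Submodule.smul_mem _ _ h1, ?_⟩
        have := N.smul_mem (algebraMap F _ c) h2
        rw [rep_alg] at this
        exact this }
  rcases hV.2 _ (V.core_isGrSub i N') with h | h
  · left
    rw [eq_bot_iff]
    intro x hx
    have : (x : V.carrier) ∈ V.core i N' := by
      intro k
      rw [V.pr_smul_self i k x x.2]
      have h2 := N.smul_mem (FreeAlgebra.ι F (DirectSum.decompose 𝒜 k 0)) hx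
      rw [rep_ι] at h2
      exact ⟨_, h2⟩
    rw [h] at this
    exact Subtype.ext this
  · right
    rw [eq_top_iff]
    intro x _
    have : (x : V.carrier) ∈ V.core i N' := by rw [h]; trivial
    have := this 1
    rw [one_smul, V.pr_same x.2] at this
    exact this.2

theorem rep_scale
    (hfrac : ∀ x : F, ∃ a b : A, algebraMap A F b ≠ 0 ∧ x * algebraMap A F b = algebraMap A F a)
    (r : FreeAlgebra F (𝒜 0)) :
    ∃ (b : A) (h : 𝒜 0), algebraMap A F b ≠ 0 ∧
      ∀ (V : GrMod A H 𝒜 F) (i : ℤ) (x : V.grading i),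
        V.degAct h i x = algebraMap A F b • (r • x) := by
  have hact : ∀ (V : GrMod A H 𝒜 F) (i : ℤ) (x : V.grading i) (h : 𝒜 0) (a : A),
      V.degAct (a • h) i x = algebraMap A F a • V.degAct h i x := by
    intro V i x h a
    apply Subtype.ext
    change (a • (h : H)) • (x : V.carrier) = algebraMap A F a • ((h : H) • (x : V.carrier))
    rw [Algebra.smul_def, mul_smul, V.compat]
  induction r using FreeAlgebra.induction with
  | grade0 c =>
    obtain ⟨a, b, hb, hab⟩ := hfrac c
    refine ⟨b, a • ⟨1, SetLike.GradedOne.one_mem⟩, hb, ?_⟩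
    intro V i x
    rw [hact, rep_alg, smul_smul, mul_comm, hab]
    congr 1
    apply Subtype.ext
    exact one_smul H (x : V.carrier)
  | grade1 h =>
    refine ⟨1, h, by simp, ?_⟩
    intro V i x
    rw [rep_ι, map_one, one_smul]
  | mul r s ihr ihs =>
    obtain ⟨b, h, hb, e⟩ := ihr
    obtain ⟨b', h', hb', e'⟩ := ihs
    refine ⟨b * b', ⟨(h : H) * (h' : H), ?_⟩, ?_, ?_⟩
    · have := SetLike.GradedMul.mul_mem h.2 h'.2
      rwa [add_zero] at this
    · rw [map_mul]; exact mul_ne_zero hb hb'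
    · intro V i x
      have : V.degAct ⟨(h : H) * (h' : H), by
          have := SetLike.GradedMul.mul_mem h.2 h'.2
          rwa [add_zero] at this⟩ i x = V.degAct h i (V.degAct h' i x) :=
        Subtype.ext (mul_smul _ _ _)
      rw [this, e', map_smul, e, mul_smul, smul_smul, map_mul, mul_comm]
  | add r s ihr ihs =>
    obtain ⟨b, h, hb, e⟩ := ihr
    obtain ⟨b', h', hb', e'⟩ := ihs
    refine ⟨b * b', b' • h + b • h', ?_, ?_⟩
    · rw [map_mul]; exact mul_ne_zero hb hb'
    · intro V i x
      have : V.degAct (b' • h + b • h') i x = V.degAct (b' • h) i x + V.degAct (b • h') i x :=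
        Subtype.ext (add_smul _ _ _)
      rw [this, hact, hact, e, e', add_smul, smul_add, smul_smul, smul_smul, map_mul, mul_comm]

theorem separate
    (hfrac : ∀ x : F, ∃ a b : A, algebraMap A F b ≠ 0 ∧ x * algebraMap A F b = algebraMap A F a)
    (M : GrMod A H 𝒜 F) (hM : M.GrSimple) (l : List (GrMod A H 𝒜 F))
    (hl : ∀ N ∈ l, N.GrSimple) (hno : ∀ N ∈ l, ¬ M.GrIso N) :
    ∃ (h : 𝒜 0) (i : ℤ) (c : F), (M.cpoly h i).IsRoot c ∧ ∀ N ∈ l, ¬ (N.cpoly h i).IsRoot c := by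
  classical
  obtain ⟨i, z, hz⟩ : ∃ (i : ℤ) (z : M.grading i), z ≠ 0 := by
    by_contra hc
    push Not at hc
    obtain ⟨x, hx⟩ := (@exists_ne _ hM.1 (0 : M.carrier))
    exact hx (M.eq_zero_of_pr fun i => congrArg Subtype.val (hc i ⟨M.pr i x, M.pr_mem i x⟩))
  have hnt : Nontrivial (M.grading i) := ⟨z, 0, hz⟩
  have hsimp : IsSimpleModule (FreeAlgebra F (𝒜 0)) (M.grading i) := M.rep_simple hM i
  have hT : ∀ j, IsSemisimpleModule (FreeAlgebra F (𝒜 0)) ((l.get j).grading i) := by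
    intro j
    rcases subsingleton_or_nontrivial ((l.get j).grading i) with h | h
    · exact (isSemisimpleModule_iff _ _).mpr Subsingleton.instComplementedLattice
    · have := (l.get j).rep_simple (hl _ (List.get_mem _ _)) i
      infer_instance
  have key : ∀ j, IsEmpty (M.grading i ≃ₗ[FreeAlgebra F (𝒜 0)] (l.get j).grading i) := by
    intro j
    refine ⟨fun φ => hno _ (List.get_mem l j) ?_⟩
    let φ' : M.grading i ≃ₗ[F] (l.get j).grading i :=
      { φ with
        map_smul' := fun c x => by
          have := φ.map_smul (algebraMap F (FreeAlgebra F (𝒜 0)) c) x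
          rw [rep_alg, rep_alg] at this
          exact this }
    refine iso_of_deg hM (hl _ (List.get_mem _ _)) i φ' ?_ z hz
    intro h x
    have := φ.map_smul (FreeAlgebra.ι F h) x
    rw [rep_ι, rep_ι] at this
    exact this
  have out : ∀ j (f : M.grading i →ₗ[FreeAlgebra F (𝒜 0)] (l.get j).grading i), f = 0 := by
    intro j f
    rcases subsingleton_or_nontrivial ((l.get j).grading i) with h | h
    · ext x; exact congrArg Subtype.val (Subsingleton.elim (f x) 0)
    · have := (l.get j).rep_simple (hl _ (List.get_mem _ _)) i
      rcases LinearMap.bijective_or_eq_zero f with hb | hb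
      · exact ((key j).false (LinearEquiv.ofBijective f hb)).elim
      · exact hb
  have inn : ∀ j (f : (l.get j).grading i →ₗ[FreeAlgebra F (𝒜 0)] M.grading i), f = 0 := by
    intro j f
    rcases subsingleton_or_nontrivial ((l.get j).grading i) with h | h
    · ext x; rw [Subsingleton.elim x 0]; simp
    · have := (l.get j).rep_simple (hl _ (List.get_mem _ _)) i
      rcases LinearMap.bijective_or_eq_zero f with hb | hb
      · exact ((key j).false (LinearEquiv.ofBijective f hb).symm).elim
      · exact hb
  obtain ⟨r, hrM, hrN⟩ := density_sep (R := FreeAlgebra F (𝒜 0)) (F := F) (S := M.grading i)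
    (fun j : Fin l.length => (l.get j).grading i) (M.rep_alg i) (fun j => (l.get j).rep_alg i)
    out inn
  obtain ⟨b, h, hb, e⟩ := rep_scale hfrac r
  refine ⟨h, i, algebraMap A F b, ?_, ?_⟩
  · refine (Module.End.hasEigenvalue_iff_isRoot_charpoly _ _).1 ?_
    refine Module.End.hasEigenvalue_of_hasEigenvector (x := z) ⟨?_, hz⟩
    rw [Module.End.mem_eigenspace_iff, e, hrM]
  · intro N hN hroot
    obtain ⟨j, rfl⟩ := List.get_of_mem hN
    have := (Module.End.hasEigenvalue_iff_isRoot_charpoly _ _).2 hroot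
    obtain ⟨v, hv⟩ := this.exists_hasEigenvector
    have h1 := hv.apply_eq_smul
    rw [e, hrN, smul_zero] at h1
    exact (smul_ne_zero hb hv.2) h1.symm

theorem mem_iso
    (hfrac : ∀ x : F, ∃ a b : A, algebraMap A F b ≠ 0 ∧ x * algebraMap A F b = algebraMap A F a)
    (l l' : List (GrMod A H 𝒜 F)) (hl : ∀ N ∈ l, N.GrSimple) (hl' : ∀ N ∈ l', N.GrSimple)
    (heq : ∀ h i, (l.map fun M : GrMod A H 𝒜 F => M.cpoly h i).prod = (l'.map fun M : GrMod A H 𝒜 F => M.cpoly h i).prod)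
    (M : GrMod A H 𝒜 F) (hM : M ∈ l) : ∃ N ∈ l', M.GrIso N := by
  by_contra hc
  push Not at hc
  obtain ⟨h, i, c, h1, h2⟩ := separate hfrac M (hl M hM) l' hl' hc
  have hdv : M.cpoly h i ∣ (l.map fun M : GrMod A H 𝒜 F => M.cpoly h i).prod :=
    List.dvd_prod (List.mem_map.2 ⟨M, hM, rfl⟩)
  have h3 : ((l.map fun M : GrMod A H 𝒜 F => M.cpoly h i).prod).IsRoot c :=
    h1.dvd hdv
  rw [heq, Polynomial.IsRoot.def, Polynomial.eval_list_prod, List.prod_eq_zero_iff] at h3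
  simp only [List.map_map, List.mem_map] at h3
  obtain ⟨N, hN, h4⟩ := h3
  exact h2 N hN h4

theorem list_cls_eq
    (hfrac : ∀ x : F, ∃ a b : A, algebraMap A F b ≠ 0 ∧ x * algebraMap A F b = algebraMap A F a)
    (l : List (GrMod A H 𝒜 F)) : ∀ l' : List (GrMod A H 𝒜 F),
    (∀ N ∈ l, N.GrSimple) → (∀ N ∈ l', N.GrSimple) →
    (∀ h i, (l.map fun M : GrMod A H 𝒜 F => M.cpoly h i).prod = (l'.map fun M : GrMod A H 𝒜 F => M.cpoly h i).prod) →
    (l.map cls).sum = (l'.map cls).sum := by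
  induction l with
  | nil =>
    intro l' hl hl' heq
    rcases l' with _ | ⟨N, t⟩
    · rfl
    · obtain ⟨M, hM, _⟩ := mem_iso hfrac _ _ hl' hl (fun h i => (heq h i).symm) N (by simp)
      simp at hM
  | cons M t ih =>
    intro l' hl hl' heq
    obtain ⟨N, hN, hiso⟩ := mem_iso hfrac _ _ hl hl' heq M (by simp)
    obtain ⟨s, t', rfl⟩ := List.append_of_mem hN
    have := ih (s ++ t') (fun N hN => hl N (by simp [hN]))
      (fun N hN => hl' N (by
        rcases List.mem_append.1 hN with h | h <;> simp [h])) (by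
        intro h i
        have h1 := heq h i
        have hm : (M.cpoly h i).Monic := LinearMap.charpoly_monic _
        apply mul_left_cancel₀ hm.ne_zero
        simp only [List.map_cons, List.prod_cons, List.map_append, List.prod_append] at h1 ⊢
        rw [h1, ← iso_cpoly hiso]; ring)
    simp only [List.map_cons, List.sum_cons, List.map_append, List.sum_append] at this ⊢
    rw [this, iso_cls hiso]; abel

theorem cls_eq_of_cpoly
    (hfrac : ∀ x : F, ∃ a b : A, algebraMap A F b ≠ 0 ∧ x * algebraMap A F b = algebraMap A F a)
    (V W : GrMod A H 𝒜 F) (heq : ∀ h i, V.cpoly h i = W.cpoly h i) : V.cls = W.cls := by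
  obtain ⟨l, a, b, c⟩ := exists_list _ V rfl
  obtain ⟨l', a', b', c'⟩ := exists_list _ W rfl
  rw [b, b']
  exact list_cls_eq hfrac l l' a a' fun h i => by rw [← c, ← c', heq]

theorem cpoly_coeff_integral [Module.Finite A H] (V : GrMod A H 𝒜 F) (h : 𝒜 0) (i : ℤ) (m : ℕ) :
    IsIntegral A ((V.cpoly h i).coeff m) := by
  obtain ⟨p, hp, hp0⟩ := Algebra.IsIntegral.isIntegral (R := A) (h : H)
  refine charpoly_coeff_integral _ p hp ?_ m
  have hpow : ∀ (n : ℕ) (x : V.grading i),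
      ((((V.degAct h i) ^ n) x : V.grading i) : V.carrier) = ((h : H) ^ n) • (x : V.carrier) := by
    intro n
    induction n with
    | zero => intro x; simp
    | succ n ih =>
      intro x
      rw [pow_succ, Module.End.mul_apply, ih, pow_succ, mul_smul]; rfl
  apply LinearMap.ext
  intro x
  apply Subtype.ext
  rw [Polynomial.aeval_eq_sum_range, LinearMap.sum_apply]
  rw [← Polynomial.aeval_def, Polynomial.aeval_eq_sum_range] at hp0
  have h2 := congrArg (fun k : H => k • (x : V.carrier)) hp0
  simp only [Finset.sum_smul, zero_smul] at h2
  have hd : (p.map (algebraMap A F)).natDegree = p.natDegree := hp.natDegree_map _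
  rw [hd]
  simp only [Submodule.coe_sum, LinearMap.smul_apply, Submodule.coe_smul, hpow,
    Polynomial.coeff_map, LinearMap.zero_apply, Submodule.coe_zero]
  rw [← h2]
  refine Finset.sum_congr rfl fun k _ => ?_
  rw [Algebra.smul_def, mul_smul, V.compat]

end GrMod

end SimpleHelpers

/-- The graded decomposition map `d^gr_θ` is the unique map
`R_0^+(KH) → R_0^+(LH)` satisfying `p_L ∘ d = t_θ ∘ p_K`: if `d` and `d'` both send the class
of each graded `KH`-module `V` to the class of a graded `LH`-module whose characteristic
polynomials (of degree-`0` elements on graded pieces) are the `θ`-images of those of `V`,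
then `d = d'`.  In particular `d^gr_θ` does not depend on the choice of valuation ring `O`. -/
theorem graded_decomposition_map_unique
    (A : Type u) [CommRing A] [IsDomain A] [IsIntegrallyClosed A]
    (K : Type u) [Field K] [Algebra A K] [IsFractionRing A K]
    (H : Type u) [Ring H] [Algebra A H] [Module.Free A H] [Module.Finite A H]
    (𝒜 : ℤ → Submodule A H) [GradedAlgebra 𝒜]
    (L : Type u) [Field L] [Algebra A L]
    (hLfrac : ∀ x : L, ∃ a b : A,
      algebraMap A L b ≠ 0 ∧ x * algebraMap A L b = algebraMap A L a)
    (hass : SplitAlg A H L ∨ PerfectField L)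
    (d d' : Groth A H 𝒜 K →+ Groth A H 𝒜 L)
    (hd : ∀ V : GrMod A H 𝒜 K, ∃ Y : GrMod A H 𝒜 L, d V.cls = Y.cls ∧
      ∀ (h : 𝒜 0) (i : ℤ) (m : ℕ) (a : A),
        (V.cpoly h i).coeff m = algebraMap A K a →
          (Y.cpoly h i).coeff m = algebraMap A L a)
    (hd' : ∀ V : GrMod A H 𝒜 K, ∃ Y : GrMod A H 𝒜 L, d' V.cls = Y.cls ∧
      ∀ (h : 𝒜 0) (i : ℤ) (m : ℕ) (a : A),
        (V.cpoly h i).coeff m = algebraMap A K a →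
          (Y.cpoly h i).coeff m = algebraMap A L a) :
    d = d' := by
  have key : ∀ V : GrMod A H 𝒜 K, d V.cls = d' V.cls := by
    intro V
    obtain ⟨Y, hY, h1⟩ := hd V
    obtain ⟨Y', hY', h2⟩ := hd' V
    rw [hY, hY']
    refine GrMod.cls_eq_of_cpoly hLfrac Y Y' fun h i => ?_
    apply Polynomial.ext
    intro m
    obtain ⟨a, ha⟩ := IsIntegrallyClosed.isIntegral_iff.1 (V.cpoly_coeff_integral h i m)
    rw [h1 h i m a ha.symm, h2 h i m a ha.symm]
  apply AddMonoidHom.ext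
  intro x
  obtain ⟨z, rfl⟩ := QuotientAddGroup.mk_surjective x
  let q : FreeAbelianGroup (GrMod A H 𝒜 K) →+ Groth A H 𝒜 K :=
    QuotientAddGroup.mk' (AddSubgroup.closure (grRelSet A H 𝒜 K))
  have e : d.comp q = d'.comp q := by
    apply FreeAbelianGroup.lift_ext
    intro V
    exact key V
  exact DFunLike.congr_fun e z
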